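/- arXiv:2411.12912 — 2 statements merged into one kernel-verified Lean document; each statement's English description precedes it below -/
import Mathlib

section
/- Let A satisfy the Setup (degree function, subalgebras A⁺ and A⁻ satisfying the directedness conditions (i) and (ii)). Then (A, A⁺, A⁻) is Reedy if and only if for each degree l there is an isomorphism of k-vector spaces ⊕_{deg(eᵢ)=l} A⁺eᵢ ⊗ₖ eᵢA⁻ ≅ Jₗ/J_{l-1}, induced by multiplication, where Jₗ = A(ε₀ + ⋯ + εₗ)A and J₋₁ = 0. -/
open scoped TensorProduct DirectSum

/-- The corner subspace `f·S·e` of an algebra `A`, for `S ⊆ A`. -/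
def cornerSpace (k : Type*) [Field k] {A : Type*} [Ring A] [Algebra k A]
    (f e : A) (S : Set A) : Submodule k A :=
  Submodule.span k {x | ∃ a ∈ S, x = f * a * e}

/-- Multiplication, as a linear map on the tensor product of two subspaces of an algebra. -/
noncomputable def mulTensor (k : Type*) [Field k] {A : Type*} [Ring A] [Algebra k A]
    (M N : Submodule k A) : (M ⊗[k] N) →ₗ[k] A :=
  TensorProduct.lift ((LinearMap.mul k A).domRestrict₁₂ M N)

/-- The multiplication map `⊕_l (e_j·P·e_l) ⊗ (e_l·M·e_i) → A`. -/
noncomputable def reedyMulMap (k : Type*) [Field k] {A : Type*} [Ring A] [Algebra k A]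
    {ι : Type*} [Fintype ι] [DecidableEq ι]
    (e : ι → A) (P M : Set A) (j i : ι) :
    (⨁ l : ι, (↥(cornerSpace k (e j) (e l) P) ⊗[k] ↥(cornerSpace k (e l) (e i) M))) →ₗ[k] A :=
  DirectSum.toModule k ι A fun l =>
    mulTensor k (cornerSpace k (e j) (e l) P) (cornerSpace k (e l) (e i) M)

/-- A Reedy algebra structure on `A`: a complete set of pairwise orthogonal idempotents
`e`, a degree function `deg`, and unital subalgebras `Ap = A⁺`, `Am = A⁻` containing the
idempotents, such that the corners of `A⁺` are upward directed and one-dimensional on the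
diagonal, the corners of `A⁻` are downward directed and one-dimensional on the diagonal, and
multiplication induces isomorphisms `⊕_l e_j A⁺ e_l ⊗ e_l A⁻ e_i ≅ e_j A e_i`. -/
structure IsReedy (k : Type*) [Field k] {A : Type*} [Ring A] [Algebra k A]
    {ι : Type*} [Fintype ι] [DecidableEq ι]
    (e : ι → A) (deg : ι → ℕ) (Ap Am : Subalgebra k A) : Prop where
  idem : ∀ i, IsIdempotentElem (e i)
  orth : ∀ i j, i ≠ j → e i * e j = 0
  complete : ∑ i, e i = 1
  memP : ∀ i, e i ∈ Ap
  memM : ∀ i, e i ∈ Am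
  diagP : ∀ i, Module.finrank k (cornerSpace k (e i) (e i) (Ap : Set A)) = 1
  offP : ∀ i j, i ≠ j → cornerSpace k (e j) (e i) (Ap : Set A) ≠ ⊥ → deg i < deg j
  diagM : ∀ i, Module.finrank k (cornerSpace k (e i) (e i) (Am : Set A)) = 1
  offM : ∀ i j, i ≠ j → cornerSpace k (e j) (e i) (Am : Set A) ≠ ⊥ → deg j < deg i
  mul_inj : ∀ i j, Function.Injective (reedyMulMap k e (Ap : Set A) (Am : Set A) j i)
  mul_range : ∀ i j, LinearMap.range (reedyMulMap k e (Ap : Set A) (Am : Set A) j i)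
      = cornerSpace k (e j) (e i) Set.univ
/-- The corner `eAe` of an algebra, as a non-unital subalgebra: the set of elements
fixed under left and right multiplication by `e`. -/
def cornerNonUnitalSubalgebra (k : Type*) [Field k] {A : Type*} [Ring A] [Algebra k A]
    (e : A) : NonUnitalSubalgebra k A where
  carrier := {x | e * x = x ∧ x * e = x}
  add_mem' := fun ha hb => ⟨by rw [mul_add, ha.1, hb.1], by rw [add_mul, ha.2, hb.2]⟩
  zero_mem' := ⟨mul_zero e, zero_mul e⟩
  mul_mem' := fun ha hb => ⟨by rw [← mul_assoc, ha.1], by rw [mul_assoc, hb.2]⟩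
  smul_mem' := fun c x hx => ⟨by rw [mul_smul_comm, hx.1], by rw [smul_mul_assoc, hx.2]⟩

/-- The corner ring `eAe` attached to an idempotent `e` of an algebra `A`. -/
def CornerRing (k : Type*) [Field k] {A : Type*} [Ring A] [Algebra k A]
    (e : {x : A // IsIdempotentElem x}) : Type _ :=
  ↥(cornerNonUnitalSubalgebra k (e : A))

instance CornerRing.instRing (k : Type*) [Field k] {A : Type*} [Ring A] [Algebra k A]
    (e : {x : A // IsIdempotentElem x}) : Ring (CornerRing k e) :=
  { (inferInstance : NonUnitalRing (cornerNonUnitalSubalgebra k (e : A))) with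
    one := ⟨(e : A), e.2, e.2⟩
    one_mul := fun x => Subtype.ext x.2.1
    mul_one := fun x => Subtype.ext x.2.2 }

instance CornerRing.instModule (k : Type*) [Field k] {A : Type*} [Ring A] [Algebra k A]
    (e : {x : A // IsIdempotentElem x}) : Module k (CornerRing k e) :=
  inferInstanceAs (Module k ↥(cornerNonUnitalSubalgebra k (e : A)))

noncomputable instance CornerRing.instAlgebra (k : Type*) [Field k] {A : Type*} [Ring A]
    [Algebra k A] (e : {x : A // IsIdempotentElem x}) : Algebra k (CornerRing k e) :=
  Algebra.ofModule
    (fun c x y => Subtype.ext (smul_mul_assoc c x.1 y.1))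
    (fun c x y => Subtype.ext (mul_smul_comm c x.1 y.1))

/-- The element of the corner ring `eAe` underlying `x : A`, given proofs. -/
def CornerRing.mk (k : Type*) [Field k] {A : Type*} [Ring A] [Algebra k A]
    (e : {x : A // IsIdempotentElem x}) (x : A) (h1 : (e : A) * x = x) (h2 : x * (e : A) = x) :
    CornerRing k e := ⟨x, h1, h2⟩

/-- The ideal `Jₗ = A(ε₀ + ⋯ + εₗ)A`, as a `k`-subspace of `A`. -/
def layerIdeal (k : Type*) [Field k] {A : Type*} [Ring A] [Algebra k A]
    {ι : Type*} (e : ι → A) (deg : ι → ℕ) (l : ℕ) : Submodule k A :=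
  Submodule.span k {x | ∃ a b : A, ∃ i : ι, deg i ≤ l ∧ x = a * e i * b}

/-- The ideal `J_{l-1}`, with `J₋₁ = 0`. -/
def prevLayerIdeal (k : Type*) [Field k] {A : Type*} [Ring A] [Algebra k A]
    {ι : Type*} (e : ι → A) (deg : ι → ℕ) : ℕ → Submodule k A
  | 0 => ⊥
  | m + 1 => layerIdeal k e deg m

theorem toModule_eq_sum {k : Type*} [Field k] {V : Type*} [AddCommGroup V] [Module k V]
    {κ : Type*} [Fintype κ] [DecidableEq κ] {B : κ → Type*} [∀ g, AddCommMonoid (B g)]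
    [∀ g, Module k (B g)] (f : ∀ g, B g →ₗ[k] V) (x : ⨁ g, B g) :
    DirectSum.toModule k κ V f x = ∑ g, f g (x g) := by
  have : DirectSum.toModule k κ V f
      = ∑ g, (f g).comp (DirectSum.component k κ B g) := by
    apply DirectSum.linearMap_ext
    intro i
    ext b
    simp only [LinearMap.comp_apply, DirectSum.toModule_lof, LinearMap.sum_apply]
    rw [Finset.sum_eq_single i]
    · rw [DirectSum.component.lof_self]
    · intro j _ hj
      rw [DirectSum.component.of]
      simp [hj.symm]
    · simp
  rw [this, LinearMap.sum_apply]
  rfl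

theorem toModule_inj_iff {k : Type*} [Field k] {V : Type*} [AddCommGroup V] [Module k V]
    {κ : Type*} [Fintype κ] [DecidableEq κ] {B : κ → Type*} [∀ g, AddCommMonoid (B g)]
    [∀ g, Module k (B g)] (f : ∀ g, B g →ₗ[k] V) (Q : Submodule k V) :
    Function.Injective (Q.mkQ.comp (DirectSum.toModule k κ V f)) ↔
      ∀ x : (∀ g, B g), ∑ g, f g (x g) ∈ Q → x = 0 := by
  let _ : ∀ g, AddCommGroup (B g) := fun g => Module.addCommMonoidToAddCommGroup k
  rw [injective_iff_map_eq_zero]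
  simp only [LinearMap.comp_apply, toModule_eq_sum, Submodule.mkQ_apply,
    Submodule.Quotient.mk_eq_zero]
  constructor
  · intro h x hx
    have := h ((DirectSum.linearEquivFunOnFintype k κ B).symm x) (by
      have hc : ∀ g, ((DirectSum.linearEquivFunOnFintype k κ B).symm x) g = x g := fun g =>
        congrFun ((DirectSum.linearEquivFunOnFintype k κ B).apply_symm_apply x) g
      simpa only [hc] using hx)
    simpa using this
  · intro h x hx
    have := h (fun g => x g) hx
    ext g
    exact congrFun this g

theorem toModule_inj_iff' {k : Type*} [Field k] {V : Type*} [AddCommGroup V] [Module k V]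
    {κ : Type*} [Fintype κ] [DecidableEq κ] {B : κ → Type*} [∀ g, AddCommMonoid (B g)]
    [∀ g, Module k (B g)] (f : ∀ g, B g →ₗ[k] V) :
    Function.Injective (DirectSum.toModule k κ V f) ↔
      ∀ x : (∀ g, B g), ∑ g, f g (x g) = 0 → x = 0 := by
  have := toModule_inj_iff f ⊥
  simp only [Submodule.mem_bot] at this
  rw [← this, LinearMap.coe_comp, Function.Injective.of_comp_iff]
  rw [← LinearMap.ker_eq_bot, Submodule.ker_mkQ]

theorem toModule_range {k : Type*} [Field k] {V : Type*} [AddCommGroup V] [Module k V]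
    {κ : Type*} [DecidableEq κ] {B : κ → Type*} [∀ g, AddCommMonoid (B g)]
    [∀ g, Module k (B g)] (f : ∀ g, B g →ₗ[k] V) :
    LinearMap.range (DirectSum.toModule k κ V f) = ⨆ g, LinearMap.range (f g) := by
  apply le_antisymm
  · rintro _ ⟨x, rfl⟩
    induction x using DirectSum.induction_on with
    | zero => simp
    | of i b =>
      have := DirectSum.toModule_lof (R := k) (φ := f) i b
      rw [DirectSum.lof_eq_of] at this
      rw [this]
      exact Submodule.mem_iSup_of_mem i ⟨b, rfl⟩
    | add x y hx hy => rw [map_add]; exact add_mem hx hy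
  · refine iSup_le fun g => ?_
    rintro _ ⟨b, rfl⟩
    exact ⟨DirectSum.lof k κ B g b, DirectSum.toModule_lof (R := k) (φ := f) g b⟩

theorem exists_of_mem_lower {k : Type*} [Field k] {V : Type*} [AddCommGroup V] [Module k V]
    {ι : Type*} [Fintype ι] [DecidableEq ι] {B : ι → Type*} [∀ g, AddCommMonoid (B g)]
    [∀ g, Module k (B g)] (f : ∀ g, B g →ₗ[k] V) (p : ι → Prop) (v : V)
    (hv : v ∈ ⨆ g, ⨆ (_ : p g), LinearMap.range (f g)) :
    ∃ y : (∀ g, B g), (∀ g, ¬ p g → y g = 0) ∧ ∑ g, f g (y g) = v := by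
  let F : (∀ g, B g) →ₗ[k] V := ∑ g, (f g).comp (LinearMap.proj g)
  have hF : ∀ y, F y = ∑ g, f g (y g) := fun y => by simp [F, LinearMap.sum_apply]
  let W : Submodule k (∀ g, B g) :=
    { carrier := {y | ∀ g, ¬ p g → y g = 0}
      add_mem' := fun ha hb g hg => by simp [ha g hg, hb g hg]
      zero_mem' := fun g _ => rfl
      smul_mem' := fun c x hx g hg => by simp [hx g hg] }
  have : (⨆ g, ⨆ (_ : p g), LinearMap.range (f g)) ≤ W.map F := by
    refine iSup_le fun g => iSup_le fun hg => ?_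
    rintro _ ⟨b, rfl⟩
    refine ⟨Pi.single g b, ?_, ?_⟩
    · intro h hh
      have : h ≠ g := fun e => hh (e ▸ hg)
      simp [this]
    · rw [hF, Finset.sum_eq_single g]
      · simp
      · intro h _ hh
        simp [hh]
      · simp
  obtain ⟨y, hy, rfl⟩ := this hv
  exact ⟨y, hy, (hF y).symm⟩

theorem layer_core {k : Type*} [Field k] {V : Type*} [AddCommGroup V] [Module k V]
    {ι : Type*} [Fintype ι] [DecidableEq ι] {B : ι → Type*} [∀ g, AddCommMonoid (B g)]
    [∀ g, Module k (B g)] (f : ∀ g, B g →ₗ[k] V) (deg : ι → ℕ) (J : ℕ → Submodule k V)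
    (hJ0 : J 0 = ⊥) (hJ : Monotone J) (hf : ∀ g, LinearMap.range (f g) ≤ J (deg g + 1)) :
    ((∀ x : (∀ g, B g), ∑ g, f g (x g) = 0 → x = 0) ∧
      ∀ l, J l ≤ ⨆ g, ⨆ (_ : deg g < l), LinearMap.range (f g)) ↔
    ∀ l : ℕ, Function.Injective ((J l).mkQ.comp
        (DirectSum.toModule k {i : ι // deg i = l} V fun i => f i.1)) ∧
      LinearMap.range ((J l).mkQ.comp
        (DirectSum.toModule k {i : ι // deg i = l} V fun i => f i.1))
        = Submodule.map (J l).mkQ (J (l + 1)) := by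
  let _ : ∀ g, AddCommGroup (B g) := fun g => Module.addCommMonoidToAddCommGroup k
  have hfl : ∀ g l, deg g < l → LinearMap.range (f g) ≤ J l := fun g l h =>
    (hf g).trans (hJ h)
  simp only [toModule_inj_iff, LinearMap.range_comp, toModule_range]
  constructor
  · rintro ⟨hinj, hle⟩ l
    refine ⟨?_, ?_⟩
    · intro x hx
      obtain ⟨y, hy, hyx⟩ := exists_of_mem_lower f (fun g => deg g < l) _ (hle l hx)
      let z : ∀ g, B g := fun g => if h : deg g = l then x ⟨g, h⟩ else 0
      have hz : ∑ g, f g (z g) = ∑ g : {i // deg i = l}, f g.1 (x g) := by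
        have h1 : ∀ g : {i // deg i = l}, x g = z g.1 := fun g => by simp [z, g.2]
        simp only [h1]
        rw [← Finset.sum_subtype (Finset.univ.filter fun i => deg i = l) (by simp)
          (fun g => f g (z g)), Finset.sum_filter]
        refine Finset.sum_congr rfl fun g _ => ?_
        by_cases h : deg g = l
        · simp [h]
        · simp [z, h]
      have h0 := hinj (z - y) (by
        simp only [Pi.sub_apply, map_sub, Finset.sum_sub_distrib, hz, hyx, sub_self])
      funext g
      have h1 := congrFun h0 g.1
      simpa [z, g.2, hy g.1 (by simp [g.2])] using h1
    · apply le_antisymm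
      · refine Submodule.map_mono (iSup_le fun g => hfl _ _ (by simp [g.2]))
      · rw [Submodule.map_le_iff_le_comap]
        refine (hle (l + 1)).trans (iSup_le fun g => iSup_le fun hg => ?_)
        rw [← Submodule.map_le_iff_le_comap]
        rcases Nat.lt_succ_iff_lt_or_eq.1 hg with h | h
        · have := Submodule.map_mono (f := (J l).mkQ) (hfl g l h)
          rw [Submodule.mkQ_map_self] at this
          exact this.trans bot_le
        · exact Submodule.map_mono
            (le_iSup (fun i : {i // deg i = l} => LinearMap.range (f i.1)) ⟨g, h⟩)
  · intro H
    refine ⟨?_, ?_⟩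
    · intro x hx
      have key : ∀ m, (∀ g, m ≤ deg g → x g = 0) → x = 0 := by
        intro m
        induction m with
        | zero => intro h; funext g; exact h g (Nat.zero_le _)
        | succ m ih =>
          intro h
          apply ih
          have hm := (H m).1 (fun g => x g.1) (by
            rw [← Finset.sum_filter_add_sum_filter_not Finset.univ (fun g => deg g = m)] at hx
            have e1 : ∑ g : {i // deg i = m}, f g.1 (x g.1)
                = ∑ g ∈ Finset.univ.filter (fun g => deg g = m), f g (x g) := by
              rw [← Finset.sum_subtype (Finset.univ.filter fun i => deg i = m) (by simp)
                (fun g => f g (x g))]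
            rw [e1, eq_neg_of_add_eq_zero_left hx]
            refine neg_mem (sum_mem fun g hg => ?_)
            rw [Finset.mem_filter] at hg
            by_cases h1 : deg g < m
            · exact hfl g m h1 ⟨_, rfl⟩
            · rw [h g (by omega), map_zero]; exact zero_mem _)
          intro g hg
          rcases hg.eq_or_lt with h1 | h1
          · exact congrFun hm ⟨g, h1.symm⟩
          · exact h g h1
      apply key (Finset.univ.sup deg + 1)
      intro g hg
      have : deg g ≤ Finset.univ.sup deg := Finset.le_sup (Finset.mem_univ g)
      omega
    · intro l
      induction l with
      | zero => rw [hJ0]; exact bot_le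
      | succ l ih =>
        have h2 := (H l).2
        have h3 := congrArg (Submodule.comap (J l).mkQ) h2
        rw [Submodule.comap_map_mkQ, Submodule.comap_map_mkQ] at h3
        refine (le_sup_right.trans h3.ge).trans (sup_le ?_ ?_)
        · refine ih.trans (iSup_le fun g => iSup_le fun hg => ?_)
          exact le_iSup₂_of_le g (by omega) le_rfl
        · refine iSup_le fun g => le_iSup₂_of_le g.1 (by omega) le_rfl

theorem mulTensor_tmul {k : Type*} [Field k] {A : Type*} [Ring A] [Algebra k A]
    (M N : Submodule k A) (x : M) (y : N) : mulTensor k M N (x ⊗ₜ y) = (x : A) * (y : A) := rfl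

theorem mulTensor_range {k : Type*} [Field k] {A : Type*} [Ring A] [Algebra k A]
    (M N : Submodule k A) : LinearMap.range (mulTensor k M N) = M * N :=
  Submodule.mulMap_range M N

theorem reedyMulMap_range {k : Type*} [Field k] {A : Type*} [Ring A] [Algebra k A]
    {ι : Type*} [Fintype ι] [DecidableEq ι] (e : ι → A) (P M : Set A) (j i : ι) :
    LinearMap.range (reedyMulMap k e P M j i) = ⨆ l, LinearMap.range
      (mulTensor k (cornerSpace k (e j) (e l) P) (cornerSpace k (e l) (e i) M)) :=
  toModule_range (B := fun l => ↥(cornerSpace k (e j) (e l) P) ⊗[k]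
    ↥(cornerSpace k (e l) (e i) M)) fun l =>
    mulTensor k (cornerSpace k (e j) (e l) P) (cornerSpace k (e l) (e i) M)

theorem reedyMulMap_inj_iff {k : Type*} [Field k] {A : Type*} [Ring A] [Algebra k A]
    {ι : Type*} [Fintype ι] [DecidableEq ι] (e : ι → A) (P M : Set A) (j i : ι) :
    Function.Injective (reedyMulMap k e P M j i) ↔
      ∀ x : (∀ l, ↥(cornerSpace k (e j) (e l) P) ⊗[k] ↥(cornerSpace k (e l) (e i) M)),
        ∑ l, mulTensor k (cornerSpace k (e j) (e l) P) (cornerSpace k (e l) (e i) M) (x l) = 0 →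
          x = 0 :=
  toModule_inj_iff' (B := fun l => ↥(cornerSpace k (e j) (e l) P) ⊗[k]
    ↥(cornerSpace k (e l) (e i) M)) fun l =>
    mulTensor k (cornerSpace k (e j) (e l) P) (cornerSpace k (e l) (e i) M)

theorem mem_cornerSpace_iff {k : Type*} [Field k] {A : Type*} [Ring A] [Algebra k A]
    (S : Subalgebra k A) {f e : A} (hf : IsIdempotentElem f) (he : IsIdempotentElem e)
    (hfS : f ∈ S) (heS : e ∈ S) (x : A) :
    x ∈ cornerSpace k f e (S : Set A) ↔ x ∈ S ∧ f * x = x ∧ x * e = x := by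
  constructor
  · intro hx
    refine Submodule.span_induction (p := fun x _ => x ∈ S ∧ f * x = x ∧ x * e = x)
      ?_ ?_ ?_ ?_ hx
    · rintro _ ⟨a, ha, rfl⟩
      refine ⟨S.mul_mem (S.mul_mem hfS ha) heS, ?_, ?_⟩
      · rw [← mul_assoc, ← mul_assoc, hf.eq]
      · rw [mul_assoc, he.eq]
    · exact ⟨S.zero_mem, by simp, by simp⟩
    · rintro x y _ _ ⟨h1, h2, h3⟩ ⟨h4, h5, h6⟩
      exact ⟨S.add_mem h1 h4, by rw [mul_add, h2, h5], by rw [add_mul, h3, h6]⟩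
    · rintro c x _ ⟨h1, h2, h3⟩
      exact ⟨S.smul_mem h1 c, by rw [mul_smul_comm, h2], by rw [smul_mul_assoc, h3]⟩
  · rintro ⟨h1, h2, h3⟩
    exact Submodule.subset_span ⟨x, h1, by rw [h2, h3]⟩

/-- The cutting map `x ⊗ y ↦ p x ⊗ y q`. -/
noncomputable def cutMap (k : Type*) [Field k] {A : Type*} [Ring A] [Algebra k A]
    {M M' N N' : Submodule k A} (p q : A) (hp : ∀ x ∈ M, p * x ∈ M')
    (hq : ∀ x ∈ N, x * q ∈ N') : (M ⊗[k] N) →ₗ[k] (M' ⊗[k] N') :=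
  TensorProduct.map ((LinearMap.mulLeft k p).restrict hp) ((LinearMap.mulRight k q).restrict hq)

theorem mulTensor_incl {k : Type*} [Field k] {A : Type*} [Ring A] [Algebra k A]
    {M M' N N' : Submodule k A} (hM : M' ≤ M) (hN : N' ≤ N) (z : M' ⊗[k] N') :
    mulTensor k M N (TensorProduct.map (Submodule.inclusion hM) (Submodule.inclusion hN) z)
      = mulTensor k M' N' z := by
  induction z using TensorProduct.induction_on with
  | zero => simp
  | tmul x y => rfl
  | add x y hx hy => simp only [map_add, hx, hy]

theorem mulTensor_cut {k : Type*} [Field k] {A : Type*} [Ring A] [Algebra k A]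
    {M M' N N' : Submodule k A} (p q : A) (hp : ∀ x ∈ M, p * x ∈ M')
    (hq : ∀ x ∈ N, x * q ∈ N') (z : M ⊗[k] N) :
    mulTensor k M' N' (cutMap k p q hp hq z) = p * mulTensor k M N z * q := by
  induction z using TensorProduct.induction_on with
  | zero => simp
  | tmul x y =>
    change (p * (x : A)) * ((y : A) * q) = p * ((x : A) * (y : A)) * q
    simp only [mul_assoc]
  | add x y hx hy => simp only [map_add, hx, hy, mul_add, add_mul]

theorem cut_incl {k : Type*} [Field k] {A : Type*} [Ring A] [Algebra k A]
    {M M' N N' : Submodule k A} (p q : A) (hp : ∀ x ∈ M, p * x ∈ M')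
    (hq : ∀ x ∈ N, x * q ∈ N') (hM : M' ≤ M) (hN : N' ≤ N)
    (hp' : ∀ x ∈ M', p * x = x) (hq' : ∀ x ∈ N', x * q = x) (z : M' ⊗[k] N') :
    cutMap k p q hp hq
      (TensorProduct.map (Submodule.inclusion hM) (Submodule.inclusion hN) z) = z := by
  induction z using TensorProduct.induction_on with
  | zero => simp
  | tmul x y =>
    rw [TensorProduct.map_tmul, cutMap, TensorProduct.map_tmul]
    congr 1
    · exact Subtype.ext (hp' _ x.2)
    · exact Subtype.ext (hq' _ y.2)
  | add x y hx hy => simp only [map_add, hx, hy]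

theorem sum_incl_cut {k : Type*} [Field k] {A : Type*} [Ring A] [Algebra k A]
    {ι : Type*} [Fintype ι] (e : ι → A) (hcomplete : ∑ i, e i = 1)
    {M N : Submodule k A} {M' N' : ι → Submodule k A} (hp : ∀ j, ∀ x ∈ M, e j * x ∈ M' j)
    (hq : ∀ i, ∀ x ∈ N, x * e i ∈ N' i) (hM : ∀ j, M' j ≤ M) (hN : ∀ i, N' i ≤ N)
    (z : M ⊗[k] N) :
    ∑ j, ∑ i, TensorProduct.map (Submodule.inclusion (hM j)) (Submodule.inclusion (hN i))
      (cutMap k (e j) (e i) (hp j) (hq i) z) = z := by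
  induction z using TensorProduct.induction_on with
  | zero => simp
  | tmul x y =>
    have hx : ∑ j, (⟨e j * x, hM j (hp j x x.2)⟩ : M) = x := by
      apply Subtype.ext
      rw [AddSubmonoidClass.coe_finsetSum]
      simp only [← Finset.sum_mul, hcomplete, one_mul]
    have hy : ∑ i, (⟨y * e i, hN i (hq i y y.2)⟩ : N) = y := by
      apply Subtype.ext
      rw [AddSubmonoidClass.coe_finsetSum]
      simp only [← Finset.mul_sum, hcomplete, mul_one]
    conv_rhs => rw [← hx, ← hy, TensorProduct.sum_tmul]
    refine Finset.sum_congr rfl fun j _ => ?_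
    rw [TensorProduct.tmul_sum]
    rfl
  | add x y hx hy =>
    simp only [map_add, Finset.sum_add_distrib]
    rw [hx, hy]

theorem prevLayerIdeal_eq (k : Type*) [Field k] {A : Type*} [Ring A] [Algebra k A]
    {ι : Type*} (e : ι → A) (deg : ι → ℕ) (l : ℕ) : prevLayerIdeal k e deg l =
      Submodule.span k {x | ∃ a b : A, ∃ i : ι, deg i < l ∧ x = a * e i * b} := by
  cases l with
  | zero => simp [prevLayerIdeal]
  | succ l => simp only [prevLayerIdeal, layerIdeal, Nat.lt_succ_iff]

/-- In the Setup (both directedness conditions), `(A, A⁺, A⁻)` is Reedy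
iff for every degree `l` multiplication induces an isomorphism
`⊕_{deg eᵢ = l} A⁺eᵢ ⊗ₖ eᵢA⁻ ≅ Jₗ/J_{l-1}`: composed with the projection `A → A/J_{l-1}`,
the multiplication map is injective with image `Jₗ/J_{l-1}`. -/
theorem reedy_iff_layerwise_decomposition
    (k : Type*) [Field k] (A : Type*) [Ring A] [Algebra k A] [FiniteDimensional k A]
    {ι : Type*} [Fintype ι] [DecidableEq ι]
    (e : ι → A) (deg : ι → ℕ) (Ap Am : Subalgebra k A)
    (hidem : ∀ i, IsIdempotentElem (e i))
    (horth : ∀ i j, i ≠ j → e i * e j = 0)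
    (hcomplete : ∑ i, e i = 1)
    (hmemP : ∀ i, e i ∈ Ap) (hmemM : ∀ i, e i ∈ Am)
    (hdiagP : ∀ i, Module.finrank k (cornerSpace k (e i) (e i) (Ap : Set A)) = 1)
    (hoffP : ∀ i j, i ≠ j → cornerSpace k (e j) (e i) (Ap : Set A) ≠ ⊥ → deg i < deg j)
    (hdiagM : ∀ i, Module.finrank k (cornerSpace k (e i) (e i) (Am : Set A)) = 1)
    (hoffM : ∀ i j, i ≠ j → cornerSpace k (e j) (e i) (Am : Set A) ≠ ⊥ → deg j < deg i) :
    IsReedy k e deg Ap Am ↔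
      ∀ l : ℕ,
        Function.Injective ((prevLayerIdeal k e deg l).mkQ.comp
          (DirectSum.toModule k {i : ι // deg i = l} A fun i =>
            mulTensor k (cornerSpace k 1 (e i.1) (Ap : Set A))
              (cornerSpace k (e i.1) 1 (Am : Set A)))) ∧
        LinearMap.range ((prevLayerIdeal k e deg l).mkQ.comp
          (DirectSum.toModule k {i : ι // deg i = l} A fun i =>
            mulTensor k (cornerSpace k 1 (e i.1) (Ap : Set A))
              (cornerSpace k (e i.1) 1 (Am : Set A))))
          = Submodule.map (prevLayerIdeal k e deg l).mkQ (layerIdeal k e deg l) := by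
  have h1 : IsIdempotentElem (1 : A) := IsIdempotentElem.one
  have memP : ∀ j g x, x ∈ cornerSpace k (e j) (e g) (Ap : Set A) ↔
      x ∈ Ap ∧ e j * x = x ∧ x * e g = x := fun j g x =>
    mem_cornerSpace_iff Ap (hidem j) (hidem g) (hmemP j) (hmemP g) x
  have memM : ∀ j g x, x ∈ cornerSpace k (e j) (e g) (Am : Set A) ↔
      x ∈ Am ∧ e j * x = x ∧ x * e g = x := fun j g x =>
    mem_cornerSpace_iff Am (hidem j) (hidem g) (hmemM j) (hmemM g) x
  have memP1 : ∀ g x, x ∈ cornerSpace k 1 (e g) (Ap : Set A) ↔ x ∈ Ap ∧ x * e g = x := fun g x => by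
    rw [mem_cornerSpace_iff Ap h1 (hidem g) Ap.one_mem (hmemP g) x]; simp
  have memM1 : ∀ g x, x ∈ cornerSpace k (e g) 1 (Am : Set A) ↔ x ∈ Am ∧ e g * x = x := fun g x => by
    rw [mem_cornerSpace_iff Am (hidem g) h1 (hmemM g) Am.one_mem x]; simp
  have memU : ∀ j i x, x ∈ cornerSpace k (e j) (e i) (Set.univ : Set A) ↔
      e j * x = x ∧ x * e i = x := fun j i x => by
    have := mem_cornerSpace_iff (⊤ : Subalgebra k A) (hidem j) (hidem i) trivial trivial x
    simpa using this
  have hM : ∀ g j, cornerSpace k (e j) (e g) (Ap : Set A) ≤ cornerSpace k 1 (e g) (Ap : Set A) :=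
    fun g j x hx => (memP1 g x).2 ⟨((memP j g x).1 hx).1, ((memP j g x).1 hx).2.2⟩
  have hN : ∀ g i, cornerSpace k (e g) (e i) (Am : Set A) ≤ cornerSpace k (e g) 1 (Am : Set A) :=
    fun g i x hx => (memM1 g x).2 ⟨((memM g i x).1 hx).1, ((memM g i x).1 hx).2.1⟩
  have hp : ∀ g j, ∀ x ∈ cornerSpace k 1 (e g) (Ap : Set A),
      e j * x ∈ cornerSpace k (e j) (e g) (Ap : Set A) := fun g j x hx => by
    obtain ⟨ha, hb⟩ := (memP1 g x).1 hx
    exact (memP j g _).2 ⟨Ap.mul_mem (hmemP j) ha, by rw [← mul_assoc, (hidem j).eq],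
      by rw [mul_assoc, hb]⟩
  have hq : ∀ g i, ∀ x ∈ cornerSpace k (e g) 1 (Am : Set A),
      x * e i ∈ cornerSpace k (e g) (e i) (Am : Set A) := fun g i x hx => by
    obtain ⟨ha, hb⟩ := (memM1 g x).1 hx
    exact (memM g i _).2 ⟨Am.mul_mem ha (hmemM i), by rw [← mul_assoc, hb],
      by rw [mul_assoc, (hidem i).eq]⟩
  have hp' : ∀ g j, ∀ x ∈ cornerSpace k (e j) (e g) (Ap : Set A), e j * x = x :=
    fun g j x hx => ((memP j g x).1 hx).2.1
  have hq' : ∀ g i, ∀ x ∈ cornerSpace k (e g) (e i) (Am : Set A), x * e i = x :=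
    fun g i x hx => ((memM g i x).1 hx).2.2
  have hJmono : Monotone (prevLayerIdeal k e deg) := by
    intro a b hab
    rw [prevLayerIdeal_eq, prevLayerIdeal_eq]
    apply Submodule.span_mono
    rintro _ ⟨x, y, i, hi, rfl⟩
    exact ⟨x, y, i, hi.trans_le hab, rfl⟩
  let f := fun g : ι => mulTensor k (cornerSpace k 1 (e g) (Ap : Set A))
    (cornerSpace k (e g) 1 (Am : Set A))
  have hfr : ∀ g, LinearMap.range (f g) = cornerSpace k 1 (e g) (Ap : Set A) *
    cornerSpace k (e g) 1 (Am : Set A) := fun g => mulTensor_range _ _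
  have hf : ∀ g, LinearMap.range (f g) ≤ prevLayerIdeal k e deg (deg g + 1) := by
    intro g
    rw [hfr, Submodule.mul_le, prevLayerIdeal_eq]
    intro x hx y hy
    refine Submodule.subset_span ⟨x, y, g, Nat.lt_succ_self _, ?_⟩
    rw [((memP1 g x).1 hx).2]
  have core := layer_core (B := fun g => ↥(cornerSpace k 1 (e g) (Ap : Set A)) ⊗[k]
    ↥(cornerSpace k (e g) 1 (Am : Set A))) f deg (prevLayerIdeal k e deg) rfl hJmono hf
  refine Iff.trans ?_ core
  constructor
  · intro R
    have hsmall : ∀ j i l, (deg i < l ∨ deg j < l) → ∀ a : A,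
        e j * a * e i ∈ ⨆ g, ⨆ (_ : deg g < l), LinearMap.range (f g) := by
      intro j i l hl a
      have h2 : e j * a * e i ∈ cornerSpace k (e j) (e i) (Set.univ : Set A) :=
        Submodule.subset_span ⟨a, trivial, rfl⟩
      rw [← R.mul_range i j, reedyMulMap_range] at h2
      revert h2
      refine fun h2 => SetLike.le_def.1 ?_ h2
      refine iSup_le fun g => ?_
      rw [mulTensor_range]
      by_cases hg : deg g < l
      · refine le_iSup₂_of_le g hg ?_
        rw [hfr]
        exact Submodule.mul_le.2 fun u hu v hv => Submodule.mul_mem_mul (hM g j hu) (hN g i hv)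
      · rcases hl with hl | hl
        · have hne : i ≠ g := by rintro rfl; exact hg hl
          have : cornerSpace k (e g) (e i) (Am : Set A) = ⊥ := by
            by_contra hc
            have := hoffM i g hne hc
            omega
          rw [this, Submodule.mul_bot]; exact bot_le
        · have hne : g ≠ j := by rintro rfl; exact hg hl
          have : cornerSpace k (e j) (e g) (Ap : Set A) = ⊥ := by
            by_contra hc
            have := hoffP g j hne hc
            omega
          rw [this, Submodule.bot_mul]; exact bot_le
    have hleft : ∀ i l, deg i < l → ∀ a : A,
        a * e i ∈ ⨆ g, ⨆ (_ : deg g < l), LinearMap.range (f g) := by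
      intro i l hl a
      have : a * e i = ∑ j, e j * a * e i := by
        rw [← Finset.sum_mul, ← Finset.sum_mul, hcomplete, one_mul]
      rw [this]
      exact sum_mem fun j _ => hsmall j i l (Or.inl hl) a
    have hright : ∀ j l, deg j < l → ∀ a : A,
        e j * a ∈ ⨆ g, ⨆ (_ : deg g < l), LinearMap.range (f g) := by
      intro j l hl a
      have : e j * a = ∑ i, e j * a * e i := by
        rw [← Finset.mul_sum, hcomplete, mul_one]
      rw [this]
      exact sum_mem fun i _ => hsmall j i l (Or.inr hl) a
    have hApmul : ∀ l, ∀ p ∈ Ap, ∀ x ∈ ⨆ g, ⨆ (_ : deg g < l), LinearMap.range (f g),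
        p * x ∈ ⨆ g, ⨆ (_ : deg g < l), LinearMap.range (f g) := by
      intro l p hpA x hx
      have : (⨆ g, ⨆ (_ : deg g < l), LinearMap.range (f g)) ≤
          Submodule.comap (LinearMap.mulLeft k p)
            (⨆ g, ⨆ (_ : deg g < l), LinearMap.range (f g)) := by
        refine iSup₂_le fun g hg => ?_
        rw [hfr, Submodule.mul_le]
        intro u hu v hv
        rw [Submodule.mem_comap, LinearMap.mulLeft_apply, ← mul_assoc]
        refine (le_iSup₂_of_le (f := fun g (_ : deg g < l) => LinearMap.range (f g))
          g hg le_rfl) ?_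
        rw [hfr]
        refine Submodule.mul_mem_mul ((memP1 g _).2 ⟨Ap.mul_mem hpA ((memP1 g u).1 hu).1, ?_⟩) hv
        rw [mul_assoc, ((memP1 g u).1 hu).2]
      exact this hx
    refine ⟨?_, ?_⟩
    · intro x hx
      funext g
      have : ∀ j i, (fun g => cutMap k (e j) (e i) (hp g j) (hq g i) (x g)) = 0 := by
        intro j i
        have hinj := R.mul_inj i j
        rw [reedyMulMap_inj_iff] at hinj
        apply hinj
        simp only [mulTensor_cut]
        rw [← Finset.sum_mul, ← Finset.mul_sum]
        have hx' : ∑ g, mulTensor k (cornerSpace k 1 (e g) (Ap : Set A))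
          (cornerSpace k (e g) 1 (Am : Set A)) (x g) = 0 := hx
        rw [hx', mul_zero, zero_mul]
      rw [← sum_incl_cut e hcomplete (hp g) (hq g) (hM g) (hN g) (x g)]
      refine Finset.sum_eq_zero fun j _ => Finset.sum_eq_zero fun i _ => ?_
      rw [show cutMap k (e j) (e i) (hp g j) (hq g i) (x g) = 0 from congrFun (this j i) g,
        map_zero]
    · intro l
      rw [prevLayerIdeal_eq, Submodule.span_le]
      rintro _ ⟨a, b, i, hi, rfl⟩
      have : (⨆ g, ⨆ (_ : deg g < l), LinearMap.range (f g)) ≤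
          Submodule.comap (LinearMap.mulRight k b)
            (⨆ g, ⨆ (_ : deg g < l), LinearMap.range (f g)) := by
        refine iSup₂_le fun g hg => ?_
        rw [hfr, Submodule.mul_le]
        intro u hu v hv
        rw [Submodule.mem_comap, LinearMap.mulRight_apply, mul_assoc]
        apply hApmul l u ((memP1 g u).1 hu).1
        rw [← ((memM1 g v).1 hv).2, mul_assoc]
        exact hright g l hg _
      exact this (hleft i l hi a)
  · rintro ⟨hinj, hle⟩
    refine ⟨hidem, horth, hcomplete, hmemP, hmemM, hdiagP, hoffP, hdiagM, hoffM, ?_, ?_⟩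
    · intro i j
      rw [reedyMulMap_inj_iff]
      intro z hz
      have h0 := hinj (fun g => TensorProduct.map (Submodule.inclusion (hM g j))
        (Submodule.inclusion (hN g i)) (z g)) (by
          simp only [f, mulTensor_incl]
          exact hz)
      funext g
      rw [← cut_incl (e j) (e i) (hp g j) (hq g i) (hM g j) (hN g i) (hp' g j) (hq' g i) (z g),
        show TensorProduct.map (Submodule.inclusion (hM g j))
        (Submodule.inclusion (hN g i)) (z g) = 0 from congrFun h0 g, map_zero]
      rfl
    · intro i j
      rw [reedyMulMap_range]
      apply le_antisymm
      · refine iSup_le fun g => ?_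
        rw [mulTensor_range, Submodule.mul_le]
        intro u hu v hv
        rw [memU, ← mul_assoc, hp' g j u hu, mul_assoc, hq' g i v hv]
        exact ⟨rfl, rfl⟩
      · intro x hx
        obtain ⟨hx1, hx2⟩ := (memU j i x).1 hx
        have hxJ : x ∈ prevLayerIdeal k e deg (deg i + 1) := by
          rw [prevLayerIdeal_eq]
          exact Submodule.subset_span ⟨x, 1, i, Nat.lt_succ_self _, by rw [mul_one, hx2]⟩
        obtain ⟨y, -, hy⟩ := exists_of_mem_lower
          (B := fun g => ↥(cornerSpace k 1 (e g) (Ap : Set A)) ⊗[k]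
            ↥(cornerSpace k (e g) 1 (Am : Set A))) f _ x (hle _ hxJ)
        rw [← hx2, ← hx1, ← hy, Finset.mul_sum, Finset.sum_mul]
        refine sum_mem fun g _ => Submodule.mem_iSup_of_mem g ?_
        exact ⟨cutMap k (e j) (e i) (hp g j) (hq g i) (y g), mulTensor_cut _ _ _ _ _⟩
end

section
/- Let (A, A⁺, A⁻) be a Reedy algebra over a field k with degree function deg. Define a relation on E by eᵢ ⊲ eⱼ iff deg(eᵢ) > deg(eⱼ). Then the chain of two-sided ideals 0 ⊆ Aε₀A ⊆ A(ε₀+ε₁)A ⊆ ⋯ ⊆ A(ε₀+⋯+ε_m)A = A (where εₗ is the sum of the degree-l idempotents) is a heredity chain, i.e., each quotient Jₗ/J_{l-1} is a heredity ideal in A/J_{l-1}; in particular A is quasi-hereditary. -/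
open scoped TensorProduct DirectSum

open scoped Pointwise in
/-- `J/Jp` is a heredity ideal of `A/Jp`, expressed inside `A`: both are two-sided ideals
with `Jp ≤ J`, `J` is idempotent modulo `Jp`, `J·rad(A/Jp)·J ⊆ Jp` (the preimage of
`rad(A/Jp)` in `A` being `Ideal.jacobson Jp`), and `J/Jp` is projective over `A/Jp`, i.e.
an `A`-module direct summand of a finite free `A/Jp`-module. -/
def IsHeredityStep (A : Type*) [Ring A] (Jp J : Ideal A) : Prop :=
  Jp ≤ J ∧
  (∀ x ∈ Jp, ∀ a : A, x * a ∈ Jp) ∧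
  (∀ x ∈ J, ∀ a : A, x * a ∈ J) ∧
  Submodule.span A ((J : Set A) * (J : Set A)) ⊔ Jp = J ∧
  (∀ x ∈ J, ∀ r ∈ Ideal.jacobson Jp, ∀ y ∈ J, x * r * y ∈ Jp) ∧
  ∃ (m : ℕ) (s : (↥J ⧸ (Submodule.comap J.subtype Jp)) →ₗ[A] (Fin m → A ⧸ Jp))
    (p : (Fin m → A ⧸ Jp) →ₗ[A] (↥J ⧸ (Submodule.comap J.subtype Jp))),
    p.comp s = LinearMap.id

namespace ReedyAux

variable {k : Type*} [Field k] {A : Type*} [Ring A] [Algebra k A]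

theorem mem_corner {f e x : A} {S : Subalgebra k A} (hf : IsIdempotentElem f)
    (he : IsIdempotentElem e) (hfS : f ∈ S) (heS : e ∈ S) :
    x ∈ cornerSpace k f e (S : Set A) ↔ x ∈ S ∧ f * x = x ∧ x * e = x := by
  constructor
  · intro hx
    unfold cornerSpace at hx
    induction hx using Submodule.span_induction with
    | mem x hx =>
      obtain ⟨a, ha, rfl⟩ := hx
      refine ⟨S.mul_mem (S.mul_mem hfS ha) heS, ?_, ?_⟩
      · rw [← mul_assoc, ← mul_assoc, hf.eq]
      · rw [mul_assoc, he.eq]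
    | zero => exact ⟨S.zero_mem, by simp, by simp⟩
    | add x y _ _ hx hy =>
      exact ⟨S.add_mem hx.1 hy.1, by rw [mul_add, hx.2.1, hy.2.1],
        by rw [add_mul, hx.2.2, hy.2.2]⟩
    | smul c x _ hx =>
      exact ⟨S.smul_mem hx.1 c, by rw [mul_smul_comm, hx.2.1], by rw [smul_mul_assoc, hx.2.2]⟩
  · rintro ⟨h1, h2, h3⟩
    exact Submodule.subset_span ⟨x, h1, by rw [h2, h3]⟩

variable {ι : Type*} [Fintype ι] [DecidableEq ι]
  {e : ι → A} {deg : ι → ℕ} {Ap Am : Subalgebra k A}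

theorem memP (h : IsReedy k e deg Ap Am) {j n : ι} {y : A} :
    y ∈ cornerSpace k (e j) (e n) (Ap : Set A) ↔ y ∈ Ap ∧ e j * y = y ∧ y * e n = y :=
  mem_corner (h.idem j) (h.idem n) (h.memP j) (h.memP n)

theorem memM (h : IsReedy k e deg Ap Am) {j n : ι} {y : A} :
    y ∈ cornerSpace k (e j) (e n) (Am : Set A) ↔ y ∈ Am ∧ e j * y = y ∧ y * e n = y :=
  mem_corner (h.idem j) (h.idem n) (h.memM j) (h.memM n)

theorem e_mul_e (h : IsReedy k e deg Ap Am) (i j : ι) : e i * e j = if i = j then e i else 0 := by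
  split_ifs with hij
  · subst hij; exact (h.idem i).eq
  · exact h.orth i j hij

theorem degP (h : IsReedy k e deg Ap Am) {j n : ι} {y : A}
    (hy : y ∈ cornerSpace k (e j) (e n) (Ap : Set A)) (hy0 : y ≠ 0) : j = n ∨ deg n < deg j := by
  by_cases hj : j = n
  · exact Or.inl hj
  · refine Or.inr (h.offP n j (Ne.symm hj) ?_)
    intro hb; rw [hb] at hy; exact hy0 (by simpa using hy)

theorem degM (h : IsReedy k e deg Ap Am) {j n : ι} {y : A}
    (hy : y ∈ cornerSpace k (e j) (e n) (Am : Set A)) (hy0 : y ≠ 0) : j = n ∨ deg j < deg n := by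
  by_cases hj : j = n
  · exact Or.inl hj
  · refine Or.inr (h.offM n j (Ne.symm hj) ?_)
    intro hb; rw [hb] at hy; exact hy0 (by simpa using hy)

theorem scalar_of_finrank {V : Submodule k A} (hV : Module.finrank k V = 1) {x y : A}
    (hx : x ∈ V) (hx0 : x ≠ 0) (hy : y ∈ V) : ∃ c : k, y = c • x := by
  obtain ⟨c, hc⟩ := (finrank_eq_one_iff_of_nonzero' (⟨x, hx⟩ : V)
    (by simpa [Subtype.ext_iff] using hx0)).1 hV ⟨y, hy⟩
  exact ⟨c, by simpa [Subtype.ext_iff] using hc.symm⟩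

theorem e_ne_zero (h : IsReedy k e deg Ap Am) (i : ι) : e i ≠ 0 := by
  intro h0
  have h1 := h.diagP i
  have : cornerSpace k (e i) (e i) (Ap : Set A) = ⊥ := by
    rw [eq_bot_iff]
    intro x hx
    have := ((memP h).1 hx).2.1
    rw [h0, zero_mul] at this
    simp [← this]
  rw [this] at h1
  simp at h1

theorem diagP (h : IsReedy k e deg Ap Am) {i : ι} {y : A}
    (hy : y ∈ cornerSpace k (e i) (e i) (Ap : Set A)) : ∃ c : k, y = c • e i :=
  scalar_of_finrank (h.diagP i) ((memP h).2 ⟨h.memP i, (h.idem i).eq, (h.idem i).eq⟩)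
    (e_ne_zero h i) hy

theorem diagM (h : IsReedy k e deg Ap Am) {i : ι} {y : A}
    (hy : y ∈ cornerSpace k (e i) (e i) (Am : Set A)) : ∃ c : k, y = c • e i :=
  scalar_of_finrank (h.diagM i) ((memM h).2 ⟨h.memM i, (h.idem i).eq, (h.idem i).eq⟩)
    (e_ne_zero h i) hy

/-- Decomposition of a corner element. -/
theorem corner_span (h : IsReedy k e deg Ap Am) (j i : ι) (x : A) :
    e j * x * e i ∈ Submodule.span k {z | ∃ n, ∃ y ∈ cornerSpace k (e j) (e n) (Ap : Set A),
      ∃ b ∈ cornerSpace k (e n) (e i) (Am : Set A), z = y * b} := by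
  have hx : e j * x * e i ∈ cornerSpace k (e j) (e i) Set.univ :=
    Submodule.subset_span ⟨x, trivial, rfl⟩
  rw [← h.mul_range i j] at hx
  obtain ⟨t, ht⟩ := hx
  rw [← ht]
  clear ht
  induction t using DirectSum.induction_on with
  | zero => simp
  | add a b ha hb => rw [map_add]; exact add_mem ha hb
  | of n t =>
    induction t using TensorProduct.induction_on with
    | zero => simp
    | add a b ha hb => rw [map_add, map_add]; exact add_mem ha hb
    | tmul y b =>
      refine Submodule.subset_span ⟨n, y, y.2, b, b.2, ?_⟩
      rw [reedyMulMap, ← DirectSum.lof_eq_of k, DirectSum.toModule_lof]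
      simp [mulTensor]
      rfl

theorem exists_left_inv {V : Type*} [AddCommMonoid V] [Module k V] (f : V →ₗ[k] A)
    (hf : Function.Injective f) : ∃ g : A →ₗ[k] V, g ∘ₗ f = LinearMap.id := by
  letI := Module.addCommMonoidToAddCommGroup k (M := V)
  exact LinearMap.exists_leftInverse_of_injective f (LinearMap.ker_eq_bot.2 hf)

/-- Coefficient maps. -/
theorem exists_coeff (h : IsReedy k e deg Ap Am) (m i : ι)
    (φ : cornerSpace k (e m) (e i) (Am : Set A) →ₗ[k] k) :
    ∃ c : A →ₗ[k] A,
      (∀ j, ∀ y ∈ cornerSpace k (e j) (e m) (Ap : Set A),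
        ∀ b : cornerSpace k (e m) (e i) (Am : Set A), c (y * b) = φ b • y) ∧
      (∀ j n i', ∀ y ∈ cornerSpace k (e j) (e n) (Ap : Set A),
        ∀ b ∈ cornerSpace k (e n) (e i') (Am : Set A), (n ≠ m ∨ i' ≠ i) → c (y * b) = 0) := by
  have hinv : ∀ j, ∃ g, g ∘ₗ (reedyMulMap k e (Ap : Set A) (Am : Set A) j i) = LinearMap.id :=
    fun j => exists_left_inv _ (h.mul_inj i j)
  choose g hg using hinv
  let ψ : ∀ j, (↥(cornerSpace k (e j) (e m) (Ap : Set A)) ⊗[k]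
      ↥(cornerSpace k (e m) (e i) (Am : Set A))) →ₗ[k] A := fun j =>
    (cornerSpace k (e j) (e m) (Ap : Set A)).subtype ∘ₗ
      (TensorProduct.rid k _).toLinearMap ∘ₗ (LinearMap.lTensor _ φ)
  let c : A →ₗ[k] A := ∑ j, ψ j ∘ₗ DirectSum.component k ι _ m ∘ₗ g j ∘ₗ
    (LinearMap.mulLeft k (e j)) ∘ₗ (LinearMap.mulRight k (e i))
  have hc : ∀ j n (y : cornerSpace k (e j) (e n) (Ap : Set A))
      (b : cornerSpace k (e n) (e i) (Am : Set A)),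
      c (y * b) = ψ j (DirectSum.component k ι _ m (DirectSum.lof k ι
        (fun l => ↥(cornerSpace k (e j) (e l) (Ap : Set A)) ⊗[k]
          ↥(cornerSpace k (e l) (e i) (Am : Set A))) n (y ⊗ₜ b))) := by
    intro j n y b
    have hy := (memP h).1 y.2
    have hb := (memM h).1 b.2
    simp only [c, LinearMap.sum_apply]
    rw [Finset.sum_eq_single j]
    · have h1 : e j * (y * b * e i) = reedyMulMap k e (Ap : Set A) (Am : Set A) j i
          (DirectSum.lof k ι _ n (y ⊗ₜ b)) := by
        rw [reedyMulMap, DirectSum.toModule_lof]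
        simp only [mulTensor, TensorProduct.lift.tmul, LinearMap.domRestrict₁₂_apply,
          LinearMap.mul_apply']
        rw [mul_assoc (y : A), hb.2.2, ← mul_assoc, hy.2.1]
      simp only [LinearMap.comp_apply, LinearMap.mulLeft_apply, LinearMap.mulRight_apply]
      rw [h1, ← LinearMap.comp_apply (g j), hg]
      rfl
    · intro j' _ hj'
      simp only [LinearMap.comp_apply, LinearMap.mulLeft_apply, LinearMap.mulRight_apply]
      have : e j' * (y * b * e i) = 0 := by
        rw [← hy.2.1, ← mul_assoc, ← mul_assoc, ← mul_assoc, h.orth _ _ hj']; simp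
      rw [this]; simp
    · simp
  refine ⟨c, ?_, ?_⟩
  · intro j y hy b
    rw [hc j m ⟨y, hy⟩ b]
    rw [DirectSum.component.lof_self]
    simp [ψ]
  · intro j n i' y hy b hb hne
    by_cases hi : i' = i
    · subst hi
      rw [hc j n ⟨y, hy⟩ ⟨b, hb⟩, DirectSum.component.of, dif_neg (by tauto)]
      simp
    · have : y * b * e i = 0 := by
        rw [← ((memM h).1 hb).2.2, mul_assoc, mul_assoc, h.orth _ _ hi]; simp
      simp [c, this]

/-- The ideal generated by idempotents of degree `< p`. -/
def I (e : ι → A) (deg : ι → ℕ) (p : ℕ) : Ideal A :=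
  Submodule.span A {x | ∃ i : ι, deg i < p ∧ ∃ b, x = e i * b}

/-- Triangular generators. -/
def G (k : Type*) [Field k] {A : Type*} [Ring A] [Algebra k A] {ι : Type*} 
    (e : ι → A) (deg : ι → ℕ) (Ap Am : Subalgebra k A) (p : ℕ) : Set A :=
  {z | ∃ j n i, deg n < p ∧ ∃ y ∈ cornerSpace k (e j) (e n) (Ap : Set A),
      ∃ b ∈ cornerSpace k (e n) (e i) (Am : Set A), z = y * b}

theorem e_mul_mem_I {p : ℕ} {i : ι} (hi : deg i < p) (b : A) : e i * b ∈ I e deg p :=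
  Submodule.subset_span ⟨i, hi, b, rfl⟩

theorem I_mul_mem {p : ℕ} {x : A} (hx : x ∈ I e deg p) (a : A) : x * a ∈ I e deg p := by
  unfold I at hx
  induction hx using Submodule.span_induction with
  | mem x hx =>
    obtain ⟨i, hi, b, rfl⟩ := hx
    rw [mul_assoc]; exact e_mul_mem_I hi _
  | zero => simp
  | add x y _ _ hx hy => rw [add_mul]; exact add_mem hx hy
  | smul c x _ hx => rw [smul_eq_mul, mul_assoc]; exact Ideal.mul_mem_left _ _ hx

theorem I_mono {p q : ℕ} (hpq : p ≤ q) : I e deg p ≤ I e deg q :=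
  Submodule.span_mono (fun _ ⟨i, hi, hb⟩ => ⟨i, hi.trans_le hpq, hb⟩)

theorem smul_mem_I {p : ℕ} {x : A} (hx : x ∈ I e deg p) (c : k) : c • x ∈ I e deg p := by
  rw [Algebra.smul_def]; exact Ideal.mul_mem_left _ _ hx

theorem yb_mem_I (h : IsReedy k e deg Ap Am) {p : ℕ} {j n i : ι} (hn : deg n < p) {y b : A}
    (_ : y ∈ cornerSpace k (e j) (e n) (Ap : Set A))
    (hb : b ∈ cornerSpace k (e n) (e i) (Am : Set A)) : y * b ∈ I e deg p := by
  rw [← ((memM h).1 hb).2.1]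
  exact Ideal.mul_mem_left _ _ (e_mul_mem_I hn _)

theorem decomp (h : IsReedy k e deg Ap Am) (x : A) : x = ∑ j, e j * x := by
  rw [← Finset.sum_mul, h.complete, one_mul]

theorem decomp' (h : IsReedy k e deg Ap Am) (x : A) : x = ∑ j, x * e j := by
  rw [← Finset.mul_sum, h.complete, mul_one]

/-- `a * y` for `y` in `A e_n`. -/
theorem left_span (h : IsReedy k e deg Ap Am) {n : ι} {x : A} (hx : x * e n = x) :
    x ∈ Submodule.span k {z | ∃ j n', ∃ y ∈ cornerSpace k (e j) (e n') (Ap : Set A),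
      ∃ b ∈ cornerSpace k (e n') (e n) (Am : Set A), z = y * b} := by
  rw [decomp h x]
  refine Submodule.sum_mem _ fun j _ => ?_
  rw [← hx, ← mul_assoc]
  refine Submodule.span_mono ?_ (corner_span h j n x)
  rintro z ⟨n', y, hy, b, hb, rfl⟩
  exact ⟨j, n', y, hy, b, hb, rfl⟩

theorem mulP (h : IsReedy k e deg Ap Am) {i j l : ι} {x y : A}
    (hx : x ∈ cornerSpace k (e i) (e j) (Ap : Set A))
    (hy : y ∈ cornerSpace k (e j) (e l) (Ap : Set A)) :
    x * y ∈ cornerSpace k (e i) (e l) (Ap : Set A) := by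
  rw [memP h] at *
  exact ⟨Ap.mul_mem hx.1 hy.1, by rw [← mul_assoc, hx.2.1], by rw [mul_assoc, hy.2.2]⟩

theorem mulM (h : IsReedy k e deg Ap Am) {i j l : ι} {x y : A}
    (hx : x ∈ cornerSpace k (e i) (e j) (Am : Set A))
    (hy : y ∈ cornerSpace k (e j) (e l) (Am : Set A)) :
    x * y ∈ cornerSpace k (e i) (e l) (Am : Set A) := by
  rw [memM h] at *
  exact ⟨Am.mul_mem hx.1 hy.1, by rw [← mul_assoc, hx.2.1], by rw [mul_assoc, hy.2.2]⟩

theorem mul_G (h : IsReedy k e deg Ap Am) {p : ℕ} (a : A) {x : A}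
    (hx : x ∈ Submodule.span k (G k e deg Ap Am p)) :
    a * x ∈ Submodule.span k (G k e deg Ap Am p) := by
  induction hx using Submodule.span_induction with
  | zero => simp
  | add x y _ _ hx hy => rw [mul_add]; exact add_mem hx hy
  | smul c x _ hx => rw [mul_smul_comm]; exact Submodule.smul_mem _ _ hx
  | mem x hx =>
    obtain ⟨j, n, i, hn, y, hy, b, hb, rfl⟩ := hx
    rw [← mul_assoc]
    have h1 : a * y * e n = a * y := by rw [mul_assoc, ((memP h).1 hy).2.2]
    have h2 := left_span h h1
    generalize a * y = w at h2
    induction h2 using Submodule.span_induction with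
    | zero => simp
    | add x y _ _ hx hy => rw [add_mul]; exact add_mem hx hy
    | smul c x _ hx => rw [smul_mul_assoc]; exact Submodule.smul_mem _ _ hx
    | mem x hx =>
      obtain ⟨j', n', y', hy', b', hb', rfl⟩ := hx
      by_cases hb0 : b' = 0
      · simp [hb0]
      · refine Submodule.subset_span ⟨j', n', i, ?_, y', hy', b' * b, mulM h hb' hb, mul_assoc _ _ _⟩
        rcases degM h hb' hb0 with rfl | hlt
        · exact hn
        · exact hlt.trans hn

theorem I_span (h : IsReedy k e deg Ap Am) {p : ℕ} {x : A} (hx : x ∈ I e deg p) :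
    x ∈ Submodule.span k (G k e deg Ap Am p) := by
  unfold I at hx
  induction hx using Submodule.span_induction with
  | zero => simp
  | add x y _ _ hx hy => exact add_mem hx hy
  | smul c x _ hx => exact mul_G h c hx
  | mem x hx =>
    obtain ⟨i, hi, b, rfl⟩ := hx
    rw [decomp' h (e i * b)]
    refine Submodule.sum_mem _ fun i' _ => ?_
    have h2 := corner_span h i i' b
    generalize e i * b * e i' = w at h2
    induction h2 using Submodule.span_induction with
    | zero => simp
    | add x y _ _ hx hy => exact add_mem hx hy
    | smul c x _ hx => exact Submodule.smul_mem _ _ hx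
    | mem x hx =>
      obtain ⟨n', y', hy', b', hb', rfl⟩ := hx
      by_cases hy0 : y' = 0
      · simp [hy0]
      · refine Submodule.subset_span ⟨i, n', i', ?_, y', hy', b', hb', rfl⟩
        rcases degP h hy' hy0 with rfl | hlt
        · exact hi
        · exact hlt.trans hi

/-- corners in degree `l` modulo lower ones -/
theorem corner_mod (h : IsReedy k e deg Ap Am) {l : ℕ} {i j : ι} (hi : deg i = l) (hj : deg j = l)
    (x : A) : ∃ c : k, e i * x * e j - c • e i ∈ I e deg l ∧ (i ≠ j → c = 0) := by
  have h2 := corner_span h i j x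
  generalize e i * x * e j = w at h2
  induction h2 using Submodule.span_induction with
  | zero => exact ⟨0, by simp⟩
  | add x y _ _ hx hy =>
    obtain ⟨c, hc, hc'⟩ := hx
    obtain ⟨d, hd, hd'⟩ := hy
    refine ⟨c + d, ?_, fun hij => by rw [hc' hij, hd' hij, add_zero]⟩
    have := add_mem hc hd
    convert this using 1
    rw [add_smul]; abel
  | smul a x _ hx =>
    obtain ⟨c, hc, hc'⟩ := hx
    refine ⟨a * c, ?_, fun hij => by rw [hc' hij, mul_zero]⟩
    rw [mul_smul, ← smul_sub]; exact smul_mem_I hc a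
  | mem x hx =>
    obtain ⟨n, y, hy, b, hb, rfl⟩ := hx
    by_cases hy0 : y = 0
    · exact ⟨0, by simp [hy0]⟩
    by_cases hb0 : b = 0
    · exact ⟨0, by simp [hb0]⟩
    rcases degP h hy hy0 with rfl | hlt
    · rcases degM h hb hb0 with rfl | hlt
      · obtain ⟨c, rfl⟩ := diagP h hy
        obtain ⟨d, rfl⟩ := diagM h hb
        refine ⟨c * d, ?_, by simp⟩
        rw [smul_mul_smul_comm, (h.idem _).eq, sub_self]; exact zero_mem _
      · omega
    · exact ⟨0, by simpa using yb_mem_I h (by omega) hy hb, by simp⟩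

theorem idem_mem_of_jacobson {I : Ideal A} [I.IsTwoSided] {f : A} (hf : IsIdempotentElem f)
    (hfI : f ∈ I.jacobson) : f ∈ I := by
  rw [Ideal.mem_jacobson_iff] at hfI
  obtain ⟨z, hz⟩ := hfI (-1)
  have h1 : (z * -1 * f + z - 1) * f ∈ I := Ideal.mul_mem_right _ _ hz
  have h2 : (z * -1 * f + z - 1) * f = -f := by
    rw [sub_mul, add_mul, mul_assoc _ f f, hf.eq]; simp
  rw [h2] at h1
  exact neg_mem_iff.1 h1

theorem rad_step (h : IsReedy k e deg Ap Am) (l : ℕ) :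
    ∀ x ∈ I e deg (l + 1), ∀ r ∈ Ideal.jacobson (I e deg l), ∀ y ∈ I e deg (l + 1),
      x * r * y ∈ I e deg l := by
  have : (I e deg l).IsTwoSided := ⟨fun b ha => I_mul_mem ha b⟩
  intro x hx r hr y hy
  unfold I at hx
  induction hx using Submodule.span_induction generalizing r with
  | zero => simp
  | add x y _ _ hx hy => rw [add_mul, add_mul]; exact add_mem (hx r hr) (hy r hr)
  | smul c x _ hx => rw [smul_eq_mul, mul_assoc, mul_assoc, ← mul_assoc x]; exact Ideal.mul_mem_left _ _ (hx r hr)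
  | mem x hx =>
    obtain ⟨i, hi, b, rfl⟩ := hx
    have key : ∀ j, deg j < l + 1 → ∀ r ∈ Ideal.jacobson (I e deg l), e i * r * e j ∈ I e deg l := by
      intro j hj r hr
      rcases Nat.lt_succ_iff_lt_or_eq.1 hi with hi | hi
      · rw [mul_assoc]; exact e_mul_mem_I hi _
      rcases Nat.lt_succ_iff_lt_or_eq.1 hj with hj | hj
      · have := e_mul_mem_I (e := e) hj 1
        rw [mul_one] at this
        exact Ideal.mul_mem_left _ _ this
      obtain ⟨c, hc, hc'⟩ := corner_mod h hi hj r
      have hce : c • e i ∈ I e deg l := by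
        by_cases hc0 : c = 0
        · simp [hc0]
        have hj1 : e i * r * e j ∈ Ideal.jacobson (I e deg l) :=
          Ideal.mul_mem_right _ _ (Ideal.mul_mem_left _ _ hr)
        have hj2 : c • e i ∈ Ideal.jacobson (I e deg l) := by
          have := sub_mem hj1 (Ideal.le_jacobson hc)
          simpa using this
        have hj3 : e i ∈ Ideal.jacobson (I e deg l) := by
          have := Ideal.mul_mem_left _ (algebraMap k A c⁻¹) hj2
          rwa [← Algebra.smul_def, smul_smul, inv_mul_cancel₀ hc0, one_smul] at this
        exact smul_mem_I (idem_mem_of_jacobson (h.idem i) hj3) c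
      have := add_mem hc hce
      simpa using this
    unfold I at hy
    have hr' : b * r ∈ Ideal.jacobson (I e deg l) := Ideal.mul_mem_left _ _ hr
    rw [mul_assoc (e i)]
    generalize b * r = r at hr'
    induction hy using Submodule.span_induction generalizing r with
    | zero => simp
    | add x y _ _ hx hy => rw [mul_add]; exact add_mem (hx r hr') (hy r hr')
    | smul c x _ hx =>
      rw [smul_eq_mul, ← mul_assoc, mul_assoc (e i)]
      exact hx (r * c) (Ideal.mul_mem_right _ _ hr')
    | mem x hx =>
      obtain ⟨j, hj, a, rfl⟩ := hx
      rw [← mul_assoc]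
      exact I_mul_mem (key j hj r hr') a

/-- The coefficient map is linear modulo lower terms. -/
theorem coeff_linear (h : IsReedy k e deg Ap Am) {l : ℕ} {m i : ι} (hm : deg m = l)
    {φ : cornerSpace k (e m) (e i) (Am : Set A) →ₗ[k] k} {c : A →ₗ[k] A}
    (h1 : ∀ j, ∀ y ∈ cornerSpace k (e j) (e m) (Ap : Set A),
        ∀ b : cornerSpace k (e m) (e i) (Am : Set A), c (y * b) = φ b • y)
    (h2 : ∀ j n i', ∀ y ∈ cornerSpace k (e j) (e n) (Ap : Set A),
        ∀ b ∈ cornerSpace k (e n) (e i') (Am : Set A), (n ≠ m ∨ i' ≠ i) → c (y * b) = 0)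
    (a : A) {x : A} (hx : x ∈ I e deg (l + 1)) : c (a * x) - a * c x ∈ I e deg l := by
  replace hx := I_span h hx
  induction hx using Submodule.span_induction with
  | zero => simp
  | add x y _ _ hx hy =>
    rw [mul_add, map_add, map_add, mul_add, add_sub_add_comm]; exact add_mem hx hy
  | smul d x _ hx =>
    rw [mul_smul_comm, map_smul, map_smul, mul_smul_comm, ← smul_sub]; exact smul_mem_I hx d
  | mem x hx =>
    obtain ⟨j, n, i', hn, y, hy, b, hb, rfl⟩ := hx
    have ha : a * y * e n = a * y := by rw [mul_assoc, ((memP h).1 hy).2.2]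
    have hs := left_span h ha
    by_cases hne : n ≠ m ∨ i' ≠ i
    · rw [h2 j n i' y hy b hb hne, mul_zero, sub_zero, ← mul_assoc]
      generalize a * y = w at hs
      induction hs using Submodule.span_induction with
      | zero => simp
      | add x y _ _ hx hy => rw [add_mul, map_add]; exact add_mem hx hy
      | smul d x _ hx => rw [smul_mul_assoc, map_smul]; exact smul_mem_I hx d
      | mem x hx =>
        obtain ⟨j', n', y', hy', b', hb', rfl⟩ := hx
        by_cases hb0 : b' = 0
        · simp [hb0]
        rw [mul_assoc, h2 j' n' i' y' hy' _ (mulM h hb' hb)]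
        · simp
        · rcases degM h hb' hb0 with rfl | hlt
          · exact hne
          · left; rintro rfl; omega
    · push Not at hne
      obtain ⟨rfl, rfl⟩ := hne
      rw [h1 j y hy ⟨b, hb⟩, mul_smul_comm, ← mul_assoc]
      generalize a * y = w at hs
      induction hs using Submodule.span_induction with
      | zero => simp
      | add x y _ _ hx hy =>
        rw [add_mul, map_add, smul_add, add_sub_add_comm]; exact add_mem hx hy
      | smul d x _ hx =>
        rw [smul_mul_assoc, map_smul, smul_comm, ← smul_sub]; exact smul_mem_I hx d
      | mem x hx =>
        obtain ⟨j', n', y', hy', b', hb', rfl⟩ := hx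
        by_cases hb0 : b' = 0
        · simp [hb0]
        rcases degM h hb' hb0 with rfl | hlt
        · obtain ⟨d, rfl⟩ := diagM h hb'
          have e1 : (d • e n') * b = d • b := by rw [smul_mul_assoc, ((memM h).1 hb).2.1]
          have e2 : y' * (d • e n') = d • y' := by rw [mul_smul_comm, ((memP h).1 hy').2.2]
          rw [e2, smul_mul_assoc, map_smul, h1 j' y' hy' ⟨b, hb⟩, smul_comm, sub_self]
          exact zero_mem _
        · rw [mul_assoc, h2 j' n' _ y' hy' _ (mulM h hb' hb), zero_sub]
          · exact neg_mem (smul_mem_I (yb_mem_I h (by omega) hy' hb') _)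
          · left; rintro rfl; omega

theorem coeff_low (h : IsReedy k e deg Ap Am) {l : ℕ} {m i : ι} (hm : deg m = l)
    {c : A →ₗ[k] A}
    (h2 : ∀ j n i', ∀ y ∈ cornerSpace k (e j) (e n) (Ap : Set A),
        ∀ b ∈ cornerSpace k (e n) (e i') (Am : Set A), (n ≠ m ∨ i' ≠ i) → c (y * b) = 0)
    {x : A} (hx : x ∈ I e deg l) : c x = 0 := by
  replace hx := I_span h hx
  induction hx using Submodule.span_induction with
  | zero => simp
  | add x y _ _ hx hy => rw [map_add, hx, hy, add_zero]
  | smul d x _ hx => rw [map_smul, hx, smul_zero]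
  | mem x hx =>
    obtain ⟨j, n, i', hn, y, hy, b, hb, rfl⟩ := hx
    exact h2 j n i' y hy b hb (Or.inl (by rintro rfl; omega))

theorem proj_step [FiniteDimensional k A] (h : IsReedy k e deg Ap Am) (l : ℕ) :
    ∃ (m : ℕ) (s : (↥(I e deg (l+1)) ⧸ (Submodule.comap (I e deg (l+1)).subtype (I e deg l))) →ₗ[A]
        (Fin m → A ⧸ I e deg l))
      (p : (Fin m → A ⧸ I e deg l) →ₗ[A]
        (↥(I e deg (l+1)) ⧸ (Submodule.comap (I e deg (l+1)).subtype (I e deg l)))),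
      p.comp s = LinearMap.id := by
  let K := Σ q : {m : ι // deg m = l} × ι,
    Fin (Module.finrank k (cornerSpace k (e q.1) (e q.2) (Am : Set A)))
  let B := fun q : {m : ι // deg m = l} × ι =>
    Module.finBasis k (cornerSpace k (e q.1) (e q.2) (Am : Set A))
  choose c hc1 hc2 using fun κ : K => exists_coeff h κ.1.1 κ.1.2 ((B κ.1).coord κ.2)
  let β : K → A := fun κ => (B κ.1 κ.2 : A)
  have hβ : ∀ κ, β κ ∈ I e deg (l + 1) := by
    intro κ
    have := ((memM h).1 (B κ.1 κ.2).2).2.1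
    simp only [β]
    rw [← this]
    exact e_mul_mem_I (by have := κ.1.1.2; omega) _
  let s0 : K → (↥(I e deg (l+1)) →ₗ[A] A ⧸ I e deg l) := fun κ =>
    { toFun := fun x => Submodule.Quotient.mk (c κ x)
      map_add' := fun x y => by simp
      map_smul' := fun a x => by
        simp only [RingHom.id_apply, ← Submodule.Quotient.mk_smul]
        rw [Submodule.Quotient.eq]
        exact coeff_linear h κ.1.1.2 (hc1 κ) (hc2 κ) a x.2 }
  let s1 : K → ((↥(I e deg (l+1)) ⧸ (Submodule.comap (I e deg (l+1)).subtype (I e deg l)))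
      →ₗ[A] A ⧸ I e deg l) := fun κ => Submodule.liftQ _ (s0 κ) (by
    intro x hx
    rw [LinearMap.mem_ker]
    simp only [s0, LinearMap.coe_mk, AddHom.coe_mk]
    rw [coeff_low h κ.1.1.2 (hc2 κ) (x := (x : A)) hx]
    rfl)
  let p1 : K → (A ⧸ I e deg l →ₗ[A]
      (↥(I e deg (l+1)) ⧸ (Submodule.comap (I e deg (l+1)).subtype (I e deg l)))) := fun κ =>
    Submodule.liftQ _ (LinearMap.toSpanSingleton A _ (Submodule.Quotient.mk ⟨β κ, hβ κ⟩)) (by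
      intro x hx
      rw [LinearMap.mem_ker, LinearMap.toSpanSingleton_apply, ← Submodule.Quotient.mk_smul,
        Submodule.Quotient.mk_eq_zero]
      exact I_mul_mem hx _)
  have hsum : ∀ x ∈ I e deg (l + 1), (∑ κ, c κ x * β κ) - x ∈ I e deg l := by
    intro x hx
    replace hx := I_span h hx
    induction hx using Submodule.span_induction with
    | zero => simp
    | add x y _ _ hx hy =>
      simp only [map_add, add_mul, Finset.sum_add_distrib]
      rw [add_sub_add_comm]; exact add_mem hx hy
    | smul d x _ hx =>
      simp only [map_smul, smul_mul_assoc, ← Finset.smul_sum]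
      rw [← smul_sub]; exact smul_mem_I hx d
    | mem x hx =>
      obtain ⟨j, n, i, hn, y, hy, b, hb, rfl⟩ := hx
      rcases Nat.lt_succ_iff_lt_or_eq.1 hn with hn | hn
      · rw [Finset.sum_eq_zero, zero_sub]
        · exact neg_mem (yb_mem_I h hn hy hb)
        · intro κ _
          rw [hc2 κ j n i y hy b hb, zero_mul]
          left; have := κ.1.1.2; intro hh; rw [← hh] at this; omega
      · have : ∑ κ, c κ (y * b) * β κ = y * b := by
          rw [Fintype.sum_sigma, Finset.sum_eq_single (⟨⟨n, hn⟩, i⟩ : {m : ι // deg m = l} × ι)]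
          · have hr := (B ⟨⟨n, hn⟩, i⟩).sum_repr ⟨b, hb⟩
            have hr' := congrArg (fun z : cornerSpace k (e n) (e i) (Am : Set A) => y * (z : A)) hr
            simp only [Submodule.coe_sum, Submodule.coe_smul, Finset.mul_sum] at hr'
            refine Eq.trans ?_ hr'
            refine Finset.sum_congr rfl fun t _ => ?_
            have := hc1 ⟨⟨⟨n, hn⟩, i⟩, t⟩ j y hy ⟨b, hb⟩
            simp only [Module.Basis.coord_apply] at this
            rw [this, smul_mul_assoc, mul_smul_comm]
          · intro q _ hq
            refine Finset.sum_eq_zero fun t _ => ?_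
            rw [hc2 ⟨q, t⟩ j n i y hy b hb, zero_mul]
            by_contra hcon
            push Not at hcon
            exact hq (Prod.ext (Subtype.ext hcon.1.symm) hcon.2.symm)
          · simp
        rw [this, sub_self]; exact zero_mem _
  let ε := Fintype.equivFin K
  refine ⟨Fintype.card K, LinearMap.pi fun t => s1 (ε.symm t),
    ∑ t, p1 (ε.symm t) ∘ₗ LinearMap.proj t, ?_⟩
  ext x
  simp only [LinearMap.comp_apply, LinearMap.sum_apply, LinearMap.proj_apply, LinearMap.pi_apply,
    LinearMap.id_apply, Submodule.mkQ_apply]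
  rw [Equiv.sum_comp ε.symm (fun κ => p1 κ (s1 κ (Submodule.Quotient.mk x)))]
  have : ∀ κ, p1 κ (s1 κ (Submodule.Quotient.mk x)) = Submodule.mkQ _ (c κ x • (⟨β κ, hβ κ⟩ : I e deg (l+1))) := by
    intro κ
    rfl
  simp only [this]
  rw [← map_sum, Submodule.mkQ_apply, Submodule.Quotient.eq]
  simpa using hsum x x.2

end ReedyAux

/-- A Reedy algebra `(A, A⁺, A⁻)` is quasi-hereditary: the chain of
two-sided ideals `0 ⊆ Aε₀A ⊆ A(ε₀+ε₁)A ⊆ ⋯ ⊆ A` (where `Jₗ` is generated by all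
idempotents of degree at most `l`) is a heredity chain, i.e. each `Jₗ/J_{l-1}` is a
heredity ideal of `A/J_{l-1}`. -/
theorem reedy_is_quasi_hereditary
    (k : Type*) [Field k] (A : Type*) [Ring A] [Algebra k A] [FiniteDimensional k A]
    {ι : Type*} [Fintype ι] [DecidableEq ι]
    (e : ι → A) (deg : ι → ℕ) (Ap Am : Subalgebra k A)
    (h : IsReedy k e deg Ap Am)
    (J : ℕ → Ideal A)
    (hJ : ∀ l : ℕ, J l = Submodule.span A {x | ∃ i : ι, deg i ≤ l ∧ ∃ b, x = e i * b}) :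
    (∃ m : ℕ, J m = ⊤) ∧
    (∀ l : ℕ, IsHeredityStep A (Nat.casesOn l ⊥ fun m => J m) (J l)) := by
  have hJ' : ∀ l, J l = ReedyAux.I e deg (l + 1) := by
    intro l
    rw [hJ]
    simp only [ReedyAux.I, Nat.lt_succ_iff]
  constructor
  · refine ⟨∑ i, deg i, ?_⟩
    rw [Ideal.eq_top_iff_one, ← h.complete, hJ']
    refine Submodule.sum_mem _ fun i _ => ?_
    have := ReedyAux.e_mul_mem_I (e := e) (Nat.lt_succ_iff.2
      (Finset.single_le_sum (fun j _ => Nat.zero_le (deg j)) (Finset.mem_univ i))) 1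
    rwa [mul_one] at this
  · intro l
    have hp : (Nat.casesOn l ⊥ fun m => J m : Ideal A) = ReedyAux.I e deg l := by
      cases l with
      | zero => simp [ReedyAux.I]
      | succ m => exact hJ' m
    rw [hp, hJ' l]
    refine ⟨ReedyAux.I_mono (Nat.le_succ l), fun x hx a => ReedyAux.I_mul_mem hx a,
      fun x hx a => ReedyAux.I_mul_mem hx a, ?_, ReedyAux.rad_step h l, ReedyAux.proj_step h l⟩
    apply le_antisymm
    · refine sup_le (Submodule.span_le.2 ?_) (ReedyAux.I_mono (Nat.le_succ l))
      rintro _ ⟨x, hx, y, hy, rfl⟩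
      exact Ideal.mul_mem_left _ _ hy
    · refine le_trans (Submodule.span_le.2 ?_) le_sup_left
      rintro _ ⟨i, hi, b, rfl⟩
      refine Submodule.subset_span ⟨e i, ?_, e i * b, ReedyAux.e_mul_mem_I hi b, ?_⟩
      · have := ReedyAux.e_mul_mem_I (e := e) hi 1
        rwa [mul_one] at this
      · show e i * (e i * b) = e i * b
        rw [← mul_assoc, (h.idem i).eq]
end
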